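/- For every positive integer N, the index of the congruence subgroup Γ₀(N) in SL(2,ℤ) equals N ∏_{p | N} (1 + 1/p), the product running over the prime divisors p of N; equivalently, [SL(2,ℤ) : Γ₀(N)] · ∏_{p | N} p = N · ∏_{p | N} (p + 1). -/

import Mathlib

open Matrix MatrixGroups

lemma index_eq_ncard_range {G α : Type*} [Group G] (H : Subgroup G) (f : G → α)
    (hf : ∀ x y, x⁻¹ * y ∈ H ↔ f x = f y) : H.index = (Set.range f).ncard := by
  rw [Subgroup.index, ← Nat.card_coe_set_eq]
  have hl : ∀ x y : G, QuotientGroup.leftRel H x y → f x = f y := fun x y h =>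
    (hf x y).1 (QuotientGroup.leftRel_apply.1 h)
  refine Nat.card_congr (Equiv.ofBijective
    (fun q : G ⧸ H => (⟨Quotient.lift f hl q, by
      induction q using Quotient.inductionOn with | _ x => exact ⟨x, rfl⟩⟩ : Set.range f)) ⟨?_, ?_⟩)
  · intro a b
    induction a using Quotient.inductionOn with | _ x => ?_
    induction b using Quotient.inductionOn with | _ y => ?_
    intro h
    exact QuotientGroup.eq.2 ((hf x y).2 (congrArg Subtype.val h))
  · rintro ⟨_, x, rfl⟩
    exact ⟨(x : G ⧸ H), rfl⟩

open Classical in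
/-- The ratio `(c / M) / a` modulo `p`, as a point of the projective line. -/
noncomputable def cosetMap (M p : ℕ) (g : CongruenceSubgroup.Gamma0 M) : Option (ZMod p) :=
  if ((g.1 0 0 : ℤ) : ZMod p) = 0 then none
  else some (((g.1 1 0 / (M : ℤ) : ℤ) : ZMod p) * (((g.1 0 0 : ℤ) : ZMod p))⁻¹)

lemma exists_entry {M : ℕ} (g : CongruenceSubgroup.Gamma0 M) :
    ∃ e : ℤ, g.1 1 0 = M * e := by
  have h := CongruenceSubgroup.Gamma0_mem.1 g.2
  exact (ZMod.intCast_zmod_eq_zero_iff_dvd _ _).1 h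

lemma cosetMap_eq_iff {M p : ℕ} (hM : 0 < M) (hp : p.Prime)
    (x y : CongruenceSubgroup.Gamma0 M) :
    x⁻¹ * y ∈ (CongruenceSubgroup.Gamma0 (p * M)).subgroupOf (CongruenceSubgroup.Gamma0 M) ↔
      cosetMap M p x = cosetMap M p y := by
  have := Fact.mk hp
  have hM' : (M : ℤ) ≠ 0 := by exact_mod_cast hM.ne'
  obtain ⟨e, he⟩ := exists_entry x
  obtain ⟨f, hf⟩ := exists_entry y
  have dx := x.1.det_coe
  have dy := y.1.det_coe
  rw [Matrix.det_fin_two] at dx dy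
  have key : x⁻¹ * y ∈ (CongruenceSubgroup.Gamma0 (p * M)).subgroupOf
      (CongruenceSubgroup.Gamma0 M) ↔
      ((x.1 0 0 : ℤ) : ZMod p) * (f : ZMod p) = (e : ZMod p) * ((y.1 0 0 : ℤ) : ZMod p) := by
    rw [Subgroup.mem_subgroupOf, CongruenceSubgroup.Gamma0_mem,
      ZMod.intCast_zmod_eq_zero_iff_dvd]
    have : ((x⁻¹ * y : CongruenceSubgroup.Gamma0 M) : SL(2, ℤ)) 1 0
        = (x.1 0 0 * f - e * y.1 0 0) * M := by
      rw [Subgroup.coe_mul, Subgroup.coe_inv, Matrix.SpecialLinearGroup.coe_mul,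
        Matrix.SpecialLinearGroup.coe_inv, Matrix.adjugate_fin_two, Matrix.mul_apply,
        Fin.sum_univ_two, hf, he]
      simp
      ring
    rw [this]
    push_cast
    rw [mul_dvd_mul_iff_right hM', ← ZMod.intCast_zmod_eq_zero_iff_dvd]
    push_cast
    rw [sub_eq_zero]
  rw [key]
  unfold cosetMap
  rw [he, hf, Int.mul_ediv_cancel_left _ hM', Int.mul_ediv_cancel_left _ hM']
  rw [he] at dx
  rw [hf] at dy
  have dx' := congrArg (Int.cast : ℤ → ZMod p) dx
  have dy' := congrArg (Int.cast : ℤ → ZMod p) dy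
  push_cast at dx' dy'
  generalize ((x.1 0 0 : ℤ) : ZMod p) = a at *
  generalize ((y.1 0 0 : ℤ) : ZMod p) = b at *
  by_cases ha : a = 0 <;> by_cases hb : b = 0
  · simp [ha, hb]
  · have : (e : ZMod p) ≠ 0 := by
      rintro h
      simp [h, ha] at dx'
    simp [ha, hb, this]
  · have : (f : ZMod p) ≠ 0 := by
      rintro h
      simp [h, hb] at dy'
    simp [ha, hb, this]
  · simp only [ha, hb, if_false, Option.some.injEq]
    field_simp
    constructor <;> intro h <;> linear_combination -h

lemma some_mem_range {M p : ℕ} (hM : 0 < M) (hp : p.Prime) (k : ZMod p) :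
    some k ∈ Set.range (cosetMap M p) := by
  have := Fact.mk hp
  have hM' : (M : ℤ) ≠ 0 := by exact_mod_cast hM.ne'
  obtain ⟨k, rfl⟩ := ZMod.intCast_surjective k
  refine ⟨⟨⟨!![1, 0; M * k, 1], by simp [Matrix.det_fin_two]⟩, ?_⟩, ?_⟩
  · refine CongruenceSubgroup.Gamma0_mem.2 ?_; simp
  · simp [cosetMap, Int.mul_ediv_cancel_left _ hM']

lemma relIndex_dvd {M p : ℕ} (hM : 0 < M) (hp : p.Prime) (h : p ∣ M) :
    (CongruenceSubgroup.Gamma0 (p * M)).relIndex (CongruenceSubgroup.Gamma0 M) = p := by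
  have := Fact.mk hp
  rw [Subgroup.relIndex, index_eq_ncard_range _ _ (cosetMap_eq_iff hM hp)]
  have : Set.range (cosetMap M p) = Set.range (some : ZMod p → _) := by
    apply Set.Subset.antisymm
    · rintro _ ⟨x, rfl⟩
      have dx := x.1.det_coe
      rw [Matrix.det_fin_two] at dx
      obtain ⟨e, he⟩ := exists_entry x
      rw [he] at dx
      have dx' := congrArg (Int.cast : ℤ → ZMod p) dx
      push_cast at dx'
      rw [(ZMod.natCast_eq_zero_iff M p).2 h] at dx'
      have : ((x.1 0 0 : ℤ) : ZMod p) ≠ 0 := by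
        intro h0
        simp [h0] at dx'
      simp [cosetMap, this]
    · rintro _ ⟨k, rfl⟩
      exact some_mem_range hM hp k
  rw [this, ← Nat.card_coe_set_eq, Nat.card_range_of_injective (Option.some_injective _)]
  simp

lemma relIndex_not_dvd {M p : ℕ} (hM : 0 < M) (hp : p.Prime) (h : ¬ p ∣ M) :
    (CongruenceSubgroup.Gamma0 (p * M)).relIndex (CongruenceSubgroup.Gamma0 M) = p + 1 := by
  have := Fact.mk hp
  rw [Subgroup.relIndex, index_eq_ncard_range _ _ (cosetMap_eq_iff hM hp)]
  have : Set.range (cosetMap M p) = Set.univ := by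
    rw [Set.eq_univ_iff_forall]
    rintro (_ | k)
    · obtain ⟨u, v, huv⟩ := Nat.isCoprime_iff_coprime.2 ((Nat.Prime.coprime_iff_not_dvd hp).2 h)
      refine ⟨⟨⟨!![(p : ℤ), -v; M, u], ?_⟩, ?_⟩, ?_⟩
      · simp [Matrix.det_fin_two]; linarith
      · refine CongruenceSubgroup.Gamma0_mem.2 ?_; simp
      · simp [cosetMap]
    · exact some_mem_range hM hp k
  rw [this, Set.ncard_univ, Finite.card_option]
  simp

/-- [SL(2,ℤ) : Γ₀(N)] = N ∏_{p ∣ N} (1 + 1/p), stated as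
[SL(2,ℤ) : Γ₀(N)] · ∏_{p ∣ N} p = N · ∏_{p ∣ N} (p + 1). -/
theorem gamma0_index (N : ℕ) (hN : 0 < N) :
    (CongruenceSubgroup.Gamma0 N).index * ∏ p ∈ N.primeFactors, p =
      N * ∏ p ∈ N.primeFactors, (p + 1) := by
  induction N using induction_on_primes with
  | zero => exact absurd hN (lt_irrefl _)
  | one =>
    have : CongruenceSubgroup.Gamma0 1 = ⊤ := by
      ext x
      simp only [CongruenceSubgroup.Gamma0_mem, Subgroup.mem_top, iff_true]
      exact Subsingleton.elim _ _
    simp [this]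
  | prime_mul p M hp ih =>
    have hM : 0 < M := Nat.pos_of_mul_pos_left hN
    have ih := ih hM
    have hle : CongruenceSubgroup.Gamma0 (p * M) ≤ CongruenceSubgroup.Gamma0 M := by
      intro x
      rw [CongruenceSubgroup.Gamma0_mem, CongruenceSubgroup.Gamma0_mem,
        ZMod.intCast_zmod_eq_zero_iff_dvd, ZMod.intCast_zmod_eq_zero_iff_dvd]
      exact fun h => (Int.natCast_dvd_natCast.2 (dvd_mul_left M p)).trans h
    rw [← Subgroup.relIndex_mul_index hle, Nat.primeFactors_mul hp.ne_zero hM.ne',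
      hp.primeFactors]
    by_cases h : p ∣ M
    · have hs : {p} ∪ M.primeFactors = M.primeFactors := by
        rw [Finset.union_eq_right, Finset.singleton_subset_iff]
        exact Nat.mem_primeFactors.2 ⟨hp, h, hM.ne'⟩
      rw [hs, relIndex_dvd hM hp h, mul_assoc, ih, mul_assoc]
    · have hs : Disjoint {p} M.primeFactors := by
        rw [Finset.disjoint_singleton_left]
        exact fun h' => h (Nat.dvd_of_mem_primeFactors h')
      rw [Finset.prod_union hs, Finset.prod_union hs, relIndex_not_dvd hM hp h,
        Finset.prod_singleton, Finset.prod_singleton]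
      linear_combination (p + 1) * p * ih
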